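/- arXiv:2311.17886 — 2 statements merged into one kernel-verified Lean document; each statement's English description precedes it below -/
import Mathlib

section
/- Let n ∈ ℕ (n ≥ 1) and W ⊆ T(ℝ^d). (1) The set of paths X in ℝ^d with X^{⊔n} ∈ 𝒱(W) is the path variety 𝒱({Σ_{x=u₁u₂⋯uₙ} u₁⧢u₂⧢⋯⧢uₙ : x ∈ W}), where the sum runs over all splittings of x into n (possibly empty) consecutive factors. (2) Identifying an n-tuple of paths (X₁,…,Xₙ) in ℝ^d with a path in ℝ^{nd}, the set of tuples with X₁⊔⋯⊔Xₙ ∈ 𝒱(W) is the path variety in ℝ^{nd} given by 𝒱({Σ_{x=u₁⋯uₙ} ι₁(u₁)⧢⋯⧢ιₙ(uₙ) : x ∈ W}), where ιⱼ : T(ℝ^d) → T(ℝ^{nd}) relabels each letter i to the letter (j−1)d + i. -/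
open scoped BigOperators TensorProduct

namespace PathVarieties

/-- Words over an alphabet `α`; the letters `{1,…,d}` of `ℝ^d` correspond to `α = Fin d`. -/
abbrev Word (α : Type*) := List α

/-- The tensor algebra `T(ℝ^d)`, identified with the free real vector space on words. -/
abbrev TA (α : Type*) := Word α →₀ ℝ

/-- The list of all (riffle) shuffles of two words. -/
def shuffles {α : Type*} : Word α → Word α → List (Word α)
  | [], v => [v]
  | a :: u, [] => [a :: u]
  | a :: u, b :: v =>
      ((shuffles u (b :: v)).map (a :: ·)) ++ ((shuffles (a :: u) v).map (b :: ·))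
termination_by u v => u.length + v.length
decreasing_by all_goals (simp only [List.length_cons]; omega)

/-- Shuffle product of two words, as an element of `T(ℝ^d)`. -/
noncomputable def shw {α : Type*} (u v : Word α) : TA α :=
  ((shuffles u v).map fun w => Finsupp.single w (1 : ℝ)).sum

/-- The shuffle product `⧢` on `T(ℝ^d)`, the bilinear extension of the shuffle of words. -/
noncomputable def sh {α : Type*} (x y : TA α) : TA α :=
  x.sum fun u cu => y.sum fun v cv => (cu * cv) • shw u v

/-- Right halfshuffle `u ≻ v` of words (`v` nonempty): shuffle `u` with `v` minus its
last letter, then append the last letter of `v`.  (This is the unique bilinear operation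
with `w ≻ a = wa` and `w ≻ (va) = (w≻v + v≻w)a`.) -/
noncomputable def rshw {α : Type*} (u v : Word α) : TA α :=
  ((shuffles u v.dropLast).map fun w =>
    Finsupp.single (w ++ v.drop (v.length - 1)) (1 : ℝ)).sum

/-- Right halfshuffle `≻` on `T^{≥1}(ℝ^d)`, extended bilinearly. -/
noncomputable def rsh {α : Type*} (x y : TA α) : TA α :=
  x.sum fun u cu => y.sum fun v cv => (cu * cv) • rshw u v

/-- Left halfshuffle `u ≺ v` of words (`u` nonempty): the first letter of `u` followed by
the shuffle of the rest of `u` with `v`.  (This is the unique bilinear operation with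
`a ≺ w = aw` and `(av) ≺ w = a(w≺v + v≺w)`.) -/
noncomputable def lshw {α : Type*} (u v : Word α) : TA α :=
  ((shuffles u.tail v).map fun w => Finsupp.single (u.take 1 ++ w) (1 : ℝ)).sum

/-- Left halfshuffle `≺` on `T^{≥1}(ℝ^d)`, extended bilinearly. -/
noncomputable def lsh {α : Type*} (x y : TA α) : TA α :=
  x.sum fun u cu => y.sum fun v cv => (cu * cv) • lshw u v

/-- The antipode `𝒜`, with `𝒜(i₁⋯iₙ) = (−1)ⁿ iₙ⋯i₁`. -/
noncomputable def antipode {α : Type*} (x : TA α) : TA α :=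
  x.sum fun w c => Finsupp.single w.reverse (((-1 : ℝ) ^ w.length) * c)

/-- Helper for `Λ_B`: value on a reversed word. -/
noncomputable def lamRev {α β : Type*} (B : α → TA β) : Word α → TA β
  | [] => Finsupp.single [] 1
  | [i] => B i
  | i :: w => rsh (lamRev B w) (B i)

/-- `Λ_B` on a word: `Λ_B e = e`, `Λ_B i = B i`, `Λ_B (w·i) = (Λ_B w) ≻ (Λ_B i)`. -/
noncomputable def lamW {α β : Type*} (B : α → TA β) (w : Word α) : TA β :=
  lamRev B w.reverse

/-- The linear map `Λ_B : T(ℝ^t) → T(ℝ^d)` induced by `B` on letters. -/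
noncomputable def Lam {α β : Type*} (B : α → TA β) (x : TA α) : TA β :=
  x.sum fun w c => c • lamW B w

/-- `splitEmb e j n w = Σ_{w = u₁⋯uₙ} e_j(u₁) ⧢ e_{j+1}(u₂) ⧢ ⋯ ⧢ e_{j+n−1}(uₙ)`,
the sum over all splittings of `w` into `n` consecutive (possibly empty) factors,
each factor relabelled letterwise by `e`. -/
noncomputable def splitEmb {α β : Type*} (e : ℕ → α → β) : ℕ → ℕ → Word α → TA β
  | _, 0, w => if w.isEmpty then Finsupp.single ([] : Word β) (1 : ℝ) else 0
  | j, k + 1, w => ∑ m ∈ Finset.range (w.length + 1),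
      sh (Finsupp.single ((w.take m).map (e j)) (1 : ℝ)) (splitEmb e (j + 1) k (w.drop m))

/-- `Σ_{x=uv} f(u)·v`: deconcatenate, evaluate the functional `f` on prefixes. -/
noncomputable def leftAct {α : Type*} (f : Word α → ℝ) (x : TA α) : TA α :=
  x.sum fun w c => c • ∑ k ∈ Finset.range (w.length + 1),
    f (w.take k) • Finsupp.single (w.drop k) (1 : ℝ)

/-- `Σ_{x=uv} u·f(v)`: deconcatenate, evaluate the functional `f` on suffixes. -/
noncomputable def rightAct {α : Type*} (f : Word α → ℝ) (x : TA α) : TA α :=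
  x.sum fun w c => c • ∑ k ∈ Finset.range (w.length + 1),
    f (w.drop k) • Finsupp.single (w.take k) (1 : ℝ)

/-- A raw path: a time horizon `T` together with a map `ℝ → ℝ^α`
(only the restriction to `[0,T]` is relevant). -/
structure RawPath (α : Type*) where
  T : ℝ
  toFun : ℝ → α → ℝ

/-- A path: positive time horizon, continuous on `[0,T]` and piecewise continuously
differentiable there (witnessed by a partition `0 = τ₀ < τ₁ < ⋯ < τₙ = T`). -/
def IsPath {α : Type*} (X : RawPath α) : Prop :=
  0 < X.T ∧ (∀ i, ContinuousOn (fun t => X.toFun t i) (Set.Icc 0 X.T)) ∧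
    ∃ (n : ℕ) (τ : Fin (n + 1) → ℝ), StrictMono τ ∧ τ 0 = 0 ∧ τ (Fin.last n) = X.T ∧
      ∀ (k : Fin n) (i : α), ContDiffOn ℝ 1 (fun t => X.toFun t i)
        (Set.Icc (τ k.castSucc) (τ k.succ))

/-- Iterated integrals, by recursion on the reversed word:
`sigRev X (i :: w) t = ∫₀ᵗ ⟨σ(X)ₛ, w.reverse⟩ dX⁽ⁱ⁾(s)`. -/
noncomputable def sigRev {α : Type*} (X : ℝ → α → ℝ) : Word α → ℝ → ℝ
  | [], _ => 1
  | i :: w, t => ∫ s in (0 : ℝ)..t, sigRev X w s * deriv (fun u => X u i) s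

/-- `⟨σ(X)_t, w⟩`, the iterated-integrals signature of `X` stopped at time `t`. -/
noncomputable def sigUpTo {α : Type*} (X : RawPath α) (t : ℝ) (w : Word α) : ℝ :=
  sigRev X.toFun w.reverse t

/-- `⟨σ(X), w⟩`, the iterated-integrals signature of the path `X` at a word `w`. -/
noncomputable def sig {α : Type*} (X : RawPath α) (w : Word α) : ℝ :=
  sigUpTo X X.T w

/-- Pairing of a word-indexed functional with an element of `T(ℝ^d)`. -/
noncomputable def pairF {α : Type*} (f : Word α → ℝ) (x : TA α) : ℝ :=
  x.sum fun w c => c * f w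

/-- `⟨σ(X), x⟩` for a tensor `x ∈ T(ℝ^d)` (linear in `x`). -/
noncomputable def pair {α : Type*} (X : RawPath α) (x : TA α) : ℝ :=
  Finsupp.linearCombination ℝ (sig X) x

/-- The path variety `𝒱(W)` of all paths whose signature kills every element of `W`. -/
def V {α : Type*} (W : Set (TA α)) : Set (RawPath α) :=
  {X | IsPath X ∧ ∀ x ∈ W, pair X x = 0}

/-- `ℐ(M)`, the space of tensors killed by the signature of every path in `M`. -/
noncomputable def Idl {α : Type*} (M : Set (RawPath α)) : Submodule ℝ (TA α) :=
  ⨅ X ∈ M, LinearMap.ker (Finsupp.linearCombination ℝ (sig X))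

/-- Concatenation `X ⊔ Y` of paths. -/
noncomputable def concat {α : Type*} (X Y : RawPath α) : RawPath α where
  T := X.T + Y.T
  toFun := fun t i =>
    if t ≤ X.T then X.toFun t i else Y.toFun (t - X.T) i + X.toFun X.T i - Y.toFun 0 i

/-- Time reversal `⟵X`. -/
def timeRev {α : Type*} (X : RawPath α) : RawPath α :=
  ⟨X.T, fun t i => X.toFun (X.T - t) i⟩

/-- `concatIter X n = X^{⊔(n+1)}`. -/
noncomputable def concatIter {α : Type*} (X : RawPath α) : ℕ → RawPath α
  | 0 => X
  | n + 1 => concat (concatIter X n) X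

/-- `X^{⊔n}`, the `n`-fold concatenation of `X` with itself (intended for `n ≥ 1`). -/
noncomputable def concatPow {α : Type*} (X : RawPath α) (n : ℕ) : RawPath α :=
  concatIter X (n - 1)

/-- `concatFold f k = f 0 ⊔ f 1 ⊔ ⋯ ⊔ f k`. -/
noncomputable def concatFold {α : Type*} (f : ℕ → RawPath α) : ℕ → RawPath α
  | 0 => f 0
  | k + 1 => concat (concatFold f k) (f (k + 1))

/-- The deconcatenation coproduct `Δ : T(ℝ^d) → T(ℝ^d) ⊗ T(ℝ^d)`,
`Δw = Σ_{w=uv} u ⊗ v`. -/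
noncomputable def deconc {α : Type*} (x : TA α) : TensorProduct ℝ (TA α) (TA α) :=
  x.sum fun w c => c • ∑ k ∈ Finset.range (w.length + 1),
    (Finsupp.single (w.take k) (1 : ℝ)) ⊗ₜ[ℝ] (Finsupp.single (w.drop k) (1 : ℝ))

section Words

variable {α : Type*}

/-- Deconcatenation convolution of two functionals on words. -/
noncomputable def conv (f g : Word α → ℝ) (w : Word α) : ℝ :=
  ∑ m ∈ Finset.range (w.length + 1), f (w.take m) * g (w.drop m)

/-- The counit: the indicator of the empty word. -/
noncomputable def counit (w : Word α) : ℝ := if w.isEmpty then 1 else 0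

theorem conv_nil (f g : Word α → ℝ) : conv f g [] = f [] * g [] := by
  simp [conv]

theorem conv_cons (f g : Word α → ℝ) (a : α) (w : Word α) :
    conv f g (a :: w) = f [] * g (a :: w) + conv (fun u => f (a :: u)) g w := by
  rw [conv, List.length_cons, Finset.sum_range_succ', add_comm]
  simp [conv]

theorem conv_add_left (f f' g : Word α → ℝ) (w : Word α) :
    conv (fun u => f u + f' u) g w = conv f g w + conv f' g w := by
  simp [conv, add_mul, Finset.sum_add_distrib]

theorem conv_const_mul_left (c : ℝ) (f g : Word α → ℝ) (w : Word α) :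
    conv (fun u => c * f u) g w = c * conv f g w := by
  simp [conv, mul_assoc, Finset.mul_sum]

theorem conv_assoc (f g h : Word α → ℝ) (w : Word α) :
    conv (conv f g) h w = conv f (conv g h) w := by
  induction w generalizing f with
  | nil => simp only [conv_nil, mul_assoc]
  | cons a w ih =>
    rw [conv_cons, conv_cons f, conv_nil, conv_cons g]
    simp only [conv_cons f g]
    rw [conv_add_left, conv_const_mul_left]
    have := ih (fun u => f (a :: u))
    rw [← this]
    ring

theorem conv_counit_right (f : Word α → ℝ) (w : Word α) : conv f counit w = f w := by
  induction w generalizing f with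
  | nil => simp [conv_nil, counit]
  | cons a w ih => rw [conv_cons, ih]; simp [counit]

theorem conv_counit_left (f : Word α → ℝ) (w : Word α) : conv counit f w = f w := by
  cases w with
  | nil => simp [conv_nil, counit]
  | cons a w => rw [conv_cons]; simp [conv, counit]

theorem conv_reverse (f g : Word α → ℝ) (w : Word α) :
    conv f g w.reverse = conv (fun u => g u.reverse) (fun u => f u.reverse) w := by
  rw [conv, conv, ← Finset.sum_range_reflect, List.length_reverse]
  refine Finset.sum_congr rfl fun m hm => ?_
  have hm' : m ≤ w.length := Nat.lt_succ_iff.mp (Finset.mem_range.mp hm)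
  have h1 : w.length + 1 - 1 - m = w.length - m := by omega
  have h2 : w.length - (w.length - m) = m := by omega
  rw [h1, List.take_reverse, List.drop_reverse, h2, mul_comm]

theorem shuffles_nil_right (u : Word α) : shuffles u [] = [u] := by
  cases u <;> simp [shuffles]

theorem shuffles_nil_left (v : Word α) : shuffles [] v = [v] := by
  simp [shuffles]

theorem shuffles_cons_cons (a b : α) (u v : Word α) :
    shuffles (a :: u) (b :: v) =
      (shuffles u (b :: v)).map (a :: ·) ++ (shuffles (a :: u) v).map (b :: ·) := by
  rw [shuffles]

theorem shuffles_append_singleton_perm (u v : Word α) (a b : α) :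
    (shuffles (u ++ [a]) (v ++ [b])).Perm
      ((shuffles u (v ++ [b])).map (· ++ [a]) ++ (shuffles (u ++ [a]) v).map (· ++ [b])) := by
  induction hk : u.length + v.length using Nat.strong_induction_on generalizing u v with
  | _ k ih =>
  subst hk
  rcases u with _ | ⟨c, u⟩ <;> rcases v with _ | ⟨e, v⟩
  · simpa [shuffles_cons_cons, shuffles_nil_left, shuffles_nil_right] using
      List.Perm.swap _ _ _
  · have h := (ih _ (by simp) [] v rfl).map (e :: ·)
    simp only [List.nil_append, List.cons_append, shuffles_cons_cons, shuffles_nil_left,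
      List.map_map, List.map_cons, List.map_nil, Function.comp_def] at h ⊢
    exact (h.cons _).trans (List.Perm.swap _ _ _)
  · have h := (ih _ (by simp) u [] rfl).map (c :: ·)
    simp only [List.nil_append, List.cons_append, shuffles_cons_cons, shuffles_nil_right,
      List.map_append, List.map_map, List.map_cons, List.map_nil, Function.comp_def] at h ⊢
    refine (h.append_right _).trans ?_
    simp only [List.append_assoc]
    exact List.Perm.append_left _ (List.perm_append_comm)
  · have h1 := (ih _ (by simp) u (e :: v) rfl).map (c :: ·)
    have h2 := (ih _ (by simp) (c :: u) v rfl).map (e :: ·)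
    simp only [List.cons_append, shuffles_cons_cons,
      List.map_append, List.map_map, Function.comp_def] at h1 h2 ⊢
    refine (h1.append h2).trans ?_
    simp only [List.append_assoc]
    refine List.Perm.append_left _ ?_
    simp only [← List.append_assoc]
    exact List.Perm.append_right _ List.perm_append_comm

theorem shuffles_reverse_perm (u v : Word α) :
    ((shuffles u v).map List.reverse).Perm (shuffles u.reverse v.reverse) := by
  induction hk : u.length + v.length using Nat.strong_induction_on generalizing u v with
  | _ k ih =>
  subst hk
  rcases u with _ | ⟨c, u⟩
  · simp [shuffles_nil_left]
  rcases v with _ | ⟨e, v⟩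
  · simp [shuffles_nil_right]
  have h1 := (ih _ (by simp) u (e :: v) rfl).map (· ++ [c])
  have h2 := (ih _ (by simp) (c :: u) v rfl).map (· ++ [e])
  simp only [List.reverse_cons, shuffles_cons_cons, List.map_append, List.map_map,
    Function.comp_def] at h1 h2 ⊢
  exact (h1.append h2).trans (shuffles_append_singleton_perm _ _ _ _).symm

end Words

section Paths

variable {α : Type*}

/-- `X` is `C¹` on every closed subinterval of `[0,T]` whose interior avoids `S`. -/
def IsC1Off (X : RawPath α) (S : Finset ℝ) : Prop :=
  ∀ a b, 0 ≤ a → a < b → b ≤ X.T → (∀ s ∈ S, s ∉ Set.Ioo a b) →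
    ∀ i, ContDiffOn ℝ 1 (fun t => X.toFun t i) (Set.Icc a b)

theorem IsC1Off.mono {X : RawPath α} {S S' : Finset ℝ} (h : IsC1Off X S) (hS : S ⊆ S') :
    IsC1Off X S' :=
  fun a b ha hab hb hs i => h a b ha hab hb (fun s hs' => hs s (hS hs')) i

theorem exists_mem_Ico_of_lt {n : ℕ} (τ : Fin (n + 1) → ℝ) {a : ℝ} (h0 : τ 0 ≤ a)
    (k : Fin (n + 1)) (hk : a < τ k) :
    ∃ j : Fin n, τ j.castSucc ≤ a ∧ a < τ j.succ := by
  induction k using Fin.induction with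
  | zero => exact absurd h0 (not_le.mpr hk)
  | succ k ih =>
    by_cases h : a < τ k.castSucc
    · exact ih h
    · exact ⟨k, not_lt.mp h, hk⟩

theorem IsPath.exists_isC1Off {X : RawPath α} (hX : IsPath X) : ∃ S, IsC1Off X S := by
  classical
  obtain ⟨-, -, n, τ, -, h0, hT, hd⟩ := hX
  refine ⟨Finset.univ.image τ, fun a b ha hab hb hs i => ?_⟩
  obtain ⟨j, hj1, hj2⟩ := exists_mem_Ico_of_lt τ (h0.trans_le ha) (Fin.last n)
    (hT.symm ▸ hab.trans_le hb)
  refine (hd j i).mono (Set.Icc_subset_Icc hj1 ?_)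
  by_contra! hlt
  exact hs (τ j.succ) (by simp) ⟨hj2, hlt⟩

theorem isPath_of_isC1Off {X : RawPath α} (hT : 0 < X.T)
    (hc : ∀ i, ContinuousOn (fun t => X.toFun t i) (Set.Icc 0 X.T)) {S : Finset ℝ}
    (hS : IsC1Off X S) : IsPath X := by
  classical
  refine ⟨hT, hc, ?_⟩
  set S' : Finset ℝ := insert 0 (insert X.T (S.filter fun s => s ∈ Set.Ioo 0 X.T)) with hS'
  have hmem : ∀ s ∈ S', 0 ≤ s ∧ s ≤ X.T := by
    intro s hs
    simp only [hS', Finset.mem_insert, Finset.mem_filter, Set.mem_Ioo] at hs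
    rcases hs with rfl | rfl | ⟨-, h1, h2⟩
    · exact ⟨le_rfl, hT.le⟩
    · exact ⟨hT.le, le_rfl⟩
    · exact ⟨h1.le, h2.le⟩
  obtain ⟨n, hn⟩ : ∃ n, S'.card = n + 1 :=
    Nat.exists_eq_succ_of_ne_zero (Finset.card_ne_zero_of_mem (Finset.mem_insert_self _ _))
  have hτm : ∀ k, S'.orderEmbOfFin hn k ∈ S' := S'.orderEmbOfFin_mem hn
  have hex : ∀ s ∈ S', ∃ k, S'.orderEmbOfFin hn k = s := by
    intro s hs
    have : s ∈ Set.range (S'.orderEmbOfFin hn) := by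
      rw [Finset.range_orderEmbOfFin]; exact hs
    exact this
  refine ⟨n, S'.orderEmbOfFin hn, (S'.orderEmbOfFin hn).strictMono, ?_, ?_, fun k i => ?_⟩
  · obtain ⟨k, hk⟩ := hex 0 (by simp [hS'])
    exact le_antisymm (hk ▸ (S'.orderEmbOfFin hn).monotone (Fin.zero_le k))
      (hmem _ (hτm 0)).1
  · obtain ⟨k, hk⟩ := hex X.T (by simp [hS'])
    exact le_antisymm (hmem _ (hτm _)).2
      (hk.symm.trans_le ((S'.orderEmbOfFin hn).monotone (Fin.le_last k)))
  · refine hS _ _ (hmem _ (hτm _)).1 ((S'.orderEmbOfFin hn).strictMono k.castSucc_lt_succ)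
      (hmem _ (hτm _)).2 (fun s hs hsI => ?_) i
    obtain ⟨l, rfl⟩ := hex s (by
      have h1 := (hmem _ (hτm k.castSucc)).1.trans_lt hsI.1
      have h2 := hsI.2.trans_le (hmem _ (hτm k.succ)).2
      simp [hS', hs, h1, h2])
    have h1 := (S'.orderEmbOfFin hn).lt_iff_lt.mp hsI.1
    have h2 := (S'.orderEmbOfFin hn).lt_iff_lt.mp hsI.2
    rw [Fin.lt_def] at h1 h2
    simp at h1 h2
    omega

theorem isPath_pi {ι : Type*} [Fintype ι] [Nonempty ι] {T : ℝ} {Xs : ι → ℝ → α → ℝ}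
    (h : ∀ j, IsPath (⟨T, Xs j⟩ : RawPath α)) :
    IsPath (⟨T, fun t p => Xs p.1 t p.2⟩ : RawPath (ι × α)) := by
  classical
  choose S hS using fun j => (h j).exists_isC1Off
  refine isPath_of_isC1Off (S := Finset.univ.biUnion S) (h (Classical.arbitrary ι)).1
    (fun p => (h p.1).2.1 p.2) fun a b ha hab hb hs p => ?_
  exact (hS p.1).mono (Finset.subset_biUnion_of_mem S (Finset.mem_univ p.1)) a b ha hab hb hs p.2

theorem concat_eqOn_left (X Y : RawPath α) (i : α) :
    Set.EqOn (fun t => (concat X Y).toFun t i) (fun t => X.toFun t i) (Set.Iic X.T) :=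
  fun _ ht => if_pos ht

theorem concat_eqOn_right (X Y : RawPath α) (i : α) :
    Set.EqOn (fun t => (concat X Y).toFun t i)
      (fun t => Y.toFun (t - X.T) i + X.toFun X.T i - Y.toFun 0 i) (Set.Ici X.T) := by
  intro t ht
  rcases eq_or_lt_of_le (Set.mem_Ici.mp ht) with rfl | h
  · simp [concat]
  · simp [concat, not_le.mpr h]

theorem isPath_concat {X Y : RawPath α} (hX : IsPath X) (hY : IsPath Y) :
    IsPath (concat X Y) := by
  classical
  obtain ⟨S, hS⟩ := hX.exists_isC1Off
  obtain ⟨S', hS'⟩ := hY.exists_isC1Off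
  have hT : (concat X Y).T = X.T + Y.T := rfl
  refine isPath_of_isC1Off (S := insert X.T (S ∪ S'.image (X.T + ·)))
    (add_pos hX.1 hY.1) (fun i => ?_) fun a b ha hab hb hs i => ?_
  · rw [hT, ← Set.Icc_union_Icc_eq_Icc hX.1.le (le_add_of_nonneg_right hY.1.le)]
    refine ContinuousOn.union_of_isClosed ?_ ?_ isClosed_Icc isClosed_Icc
    · exact (hX.2.1 i).congr ((concat_eqOn_left X Y i).mono fun t ht => ht.2)
    · refine ContinuousOn.congr ?_ ((concat_eqOn_right X Y i).mono fun t ht => ht.1)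
      refine (ContinuousOn.add ?_ continuousOn_const).sub continuousOn_const
      refine (hY.2.1 i).comp (by fun_prop) fun t ht => ⟨?_, ?_⟩
      · linarith [ht.1]
      · linarith [ht.2]
  · rcases le_or_gt b X.T with hbT | hbT
    · refine (hS a b ha hab hbT (fun s hs' => hs s ?_) i).congr
        ((concat_eqOn_left X Y i).mono fun t ht => ht.2.trans hbT)
      simp [hs']
    · have haT : X.T ≤ a := by
        by_contra! hlt
        exact hs X.T (by simp) ⟨hlt, hbT⟩
      refine ContDiffOn.congr ?_ ((concat_eqOn_right X Y i).mono fun t ht => haT.trans ht.1)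
      refine (ContDiffOn.add ?_ contDiffOn_const).sub contDiffOn_const
      refine (hS' (a - X.T) (b - X.T) (by linarith) (by linarith) (by linarith)
        (fun s hs' hsI => hs (X.T + s) ?_ ⟨?_, ?_⟩) i).comp
        (contDiff_id.sub contDiff_const).contDiffOn fun t ht => ⟨?_, ?_⟩
      · simp [hs']
      · linarith [hsI.1]
      · linarith [hsI.2]
      · simpa using ht.1
      · simpa using ht.2

end Paths

section Signature

open MeasureTheory

variable {α β : Type*}

theorem IsC1Off.continuousOn_deriv {X : RawPath α} {S : Finset ℝ} (hS : IsC1Off X S)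
    {a b : ℝ} (ha : 0 ≤ a) (hab : a < b) (hb : b ≤ X.T) (hs : ∀ s ∈ S, s ∉ Set.Ioo a b) (i : α) :
    ContinuousOn (deriv fun t => X.toFun t i) (Set.Ioo a b) :=
  ((hS a b ha hab hb hs i).mono Set.Ioo_subset_Icc_self).continuousOn_deriv_of_isOpen
    isOpen_Ioo le_rfl

theorem exists_Ioo_avoiding (S : Finset ℝ) {T t : ℝ} (ht : t ∈ Set.Ioo 0 T) (htS : t ∉ S) :
    ∃ a b, 0 ≤ a ∧ b ≤ T ∧ t ∈ Set.Ioo a b ∧ ∀ s ∈ S, s ∉ Set.Ioo a b := by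
  have hU : Set.Ioo 0 T \ (S : Set ℝ) ∈ nhds t :=
    (isOpen_Ioo.sdiff S.finite_toSet.isClosed).mem_nhds ⟨ht, htS⟩
  obtain ⟨a, b, hab, hsub⟩ := mem_nhds_iff_exists_Ioo_subset.mp hU
  have hne : (Set.Ioo a b).Nonempty := ⟨t, hab⟩
  have hcl : Set.Ioo a b ⊆ Set.Ioo 0 T := fun x hx => (hsub hx).1
  have h := (Set.Ioo_subset_Ioo_iff (hab.1.trans hab.2)).mp hcl
  exact ⟨a, b, h.1, h.2, hab, fun s hs hsI => (hsub hsI).2 hs⟩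

theorem IsPath.intervalIntegrable_deriv {X : RawPath α} (hX : IsPath X) (i : α) :
    IntervalIntegrable (deriv fun t => X.toFun t i) volume 0 X.T := by
  obtain ⟨-, -, n, τ, hmono, h0, hT, hd⟩ := hX
  rw [← h0, ← hT]
  have key : ∀ k, IntervalIntegrable (deriv fun t => X.toFun t i) volume (τ 0) (τ k) := by
    intro k
    induction k using Fin.induction with
    | zero => exact IntervalIntegrable.refl
    | succ k ih =>
      refine ih.trans ?_
      have hlt : τ k.castSucc < τ k.succ := hmono k.castSucc_lt_succ
      have hc := (hd k i).continuousOn_derivWithin (uniqueDiffOn_Icc hlt) le_rfl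
      rw [← Set.uIcc_of_le hlt.le] at hc
      refine hc.intervalIntegrable.congr_uIoo fun t ht => ?_
      rw [Set.uIoo_of_le hlt.le] at ht
      rw [Set.uIcc_of_le hlt.le]
      exact derivWithin_of_mem_nhds (Icc_mem_nhds ht.1 ht.2)
  exact key _

theorem IsPath.continuousOn_sigRev {X : RawPath α} (hX : IsPath X) (w : Word α) :
    ContinuousOn (sigRev X.toFun w) (Set.Icc 0 X.T) := by
  induction w with
  | nil => exact continuousOn_const
  | cons i w ih =>
    rw [← Set.uIcc_of_le hX.1.le] at ih ⊢
    exact intervalIntegral.continuousOn_primitive_interval'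
      ((hX.intervalIntegrable_deriv i).continuousOn_mul ih) Set.left_mem_uIcc

theorem IsPath.intervalIntegrable_mul_deriv {X : RawPath α} (hX : IsPath X) {f : ℝ → ℝ}
    (hf : ContinuousOn f (Set.Icc 0 X.T)) (i : α) {t : ℝ} (ht : t ∈ Set.Icc 0 X.T) :
    IntervalIntegrable (fun s => f s * deriv (fun u => X.toFun u i) s) volume 0 t := by
  rw [← Set.uIcc_of_le hX.1.le] at hf ht
  exact ((hX.intervalIntegrable_deriv i).continuousOn_mul hf).mono_set
    (Set.uIcc_subset_uIcc_left ht)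

theorem IsPath.hasDerivAt_sigRev {X : RawPath α} (hX : IsPath X) {S : Finset ℝ}
    (hS : IsC1Off X S) (i : α) (w : Word α) {t : ℝ} (ht : t ∈ Set.Ioo 0 X.T) (htS : t ∉ S) :
    HasDerivAt (sigRev X.toFun (i :: w))
      (sigRev X.toFun w t * deriv (fun u => X.toFun u i) t) t := by
  obtain ⟨a, b, ha, hb, hab, hs⟩ := exists_Ioo_avoiding S ht htS
  have hc : ContinuousOn (fun s => sigRev X.toFun w s * deriv (fun u => X.toFun u i) s)
      (Set.Ioo a b) :=
    ((hX.continuousOn_sigRev w).mono fun s hs' => ⟨ha.trans hs'.1.le, hs'.2.le.trans hb⟩).mul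
      (hS.continuousOn_deriv ha (hab.1.trans hab.2) hb hs i)
  exact intervalIntegral.integral_hasDerivAt_right
    (hX.intervalIntegrable_mul_deriv (hX.continuousOn_sigRev w) i ⟨ht.1.le, ht.2.le⟩)
    (hc.stronglyMeasurableAtFilter isOpen_Ioo t hab) (hc.continuousAt (Ioo_mem_nhds hab.1 hab.2))

theorem sigRev_cons_zero (X : ℝ → α → ℝ) (i : α) (w : Word α) : sigRev X (i :: w) 0 = 0 := by
  simp [sigRev]

theorem IsPath.sigRev_mul {X : RawPath α} (hX : IsPath X) (i j : α) (u v : Word α) {t : ℝ}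
    (ht : t ∈ Set.Icc 0 X.T) :
    sigRev X.toFun (i :: u) t * sigRev X.toFun (j :: v) t =
      (∫ s in (0 : ℝ)..t, sigRev X.toFun u s * sigRev X.toFun (j :: v) s *
        deriv (fun x => X.toFun x i) s) +
      ∫ s in (0 : ℝ)..t, sigRev X.toFun (i :: u) s * sigRev X.toFun v s *
        deriv (fun x => X.toFun x j) s := by
  obtain ⟨S, hS⟩ := hX.exists_isC1Off
  have hu := hX.continuousOn_sigRev u
  have hv := hX.continuousOn_sigRev v
  have hiu := hX.continuousOn_sigRev (i :: u)
  have hjv := hX.continuousOn_sigRev (j :: v)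
  have h1 := hX.intervalIntegrable_mul_deriv (hu.mul hjv) i ht
  have h2 := hX.intervalIntegrable_mul_deriv (hiu.mul hv) j ht
  have hsub : Set.Icc 0 t ⊆ Set.Icc 0 X.T := Set.Icc_subset_Icc_right ht.2
  have key := integral_eq_of_hasDerivAt_off_countable
    (fun s => sigRev X.toFun (i :: u) s * sigRev X.toFun (j :: v) s) _
    S.countable_toSet (by rw [Set.uIcc_of_le ht.1]; exact (hiu.mul hjv).mono hsub)
    (fun s hs => ?_) (h1.add h2)
  · refine Eq.trans ?_ (intervalIntegral.integral_add h1 h2)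
    simpa [sigRev_cons_zero] using key.symm
  · rw [min_eq_left ht.1, max_eq_right ht.1] at hs
    have hs' : s ∈ Set.Ioo 0 X.T := ⟨hs.1.1, hs.1.2.trans_le ht.2⟩
    refine ((hX.hasDerivAt_sigRev hS i u hs' hs.2).mul
      (hX.hasDerivAt_sigRev hS j v hs' hs.2)).congr_deriv ?_
    simp only [Pi.mul_apply]
    ring

theorem IsPath.sum_map_sigRev_cons {X : RawPath α} (hX : IsPath X) (i : α)
    (L : List (Word α)) {t : ℝ} (ht : t ∈ Set.Icc 0 X.T) :
    (L.map fun w => sigRev X.toFun (i :: w) t).sum =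
      ∫ s in (0 : ℝ)..t, (L.map fun w => sigRev X.toFun w s).sum *
        deriv (fun x => X.toFun x i) s := by
  have hc : ∀ L : List (Word α),
      ContinuousOn (fun s => (L.map fun w => sigRev X.toFun w s).sum) (Set.Icc 0 X.T) := by
    intro L
    induction L with
    | nil => exact continuousOn_const
    | cons w L ih =>
      simp only [List.map_cons, List.sum_cons]
      exact (hX.continuousOn_sigRev w).add ih
  induction L with
  | nil => simp
  | cons w L ih =>
    simp only [List.map_cons, List.sum_cons, add_mul]
    rw [ih, intervalIntegral.integral_add
      (hX.intervalIntegrable_mul_deriv (hX.continuousOn_sigRev w) i ht)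
      (hX.intervalIntegrable_mul_deriv (hc L) i ht)]
    rfl

theorem IsPath.sum_shuffles_sigRev {X : RawPath α} (hX : IsPath X) (u v : Word α) {t : ℝ}
    (ht : t ∈ Set.Icc 0 X.T) :
    ((shuffles u v).map fun w => sigRev X.toFun w t).sum =
      sigRev X.toFun u t * sigRev X.toFun v t := by
  induction hk : u.length + v.length using Nat.strong_induction_on generalizing u v t with
  | _ k ih =>
  subst hk
  rcases u with _ | ⟨i, u⟩
  · simp [shuffles_nil_left, sigRev]
  rcases v with _ | ⟨j, v⟩
  · simp [shuffles_nil_right, sigRev]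
  rw [shuffles_cons_cons, List.map_append, List.sum_append, List.map_map, List.map_map,
    hX.sigRev_mul i j u v ht]
  simp only [Function.comp_def]
  rw [hX.sum_map_sigRev_cons i _ ht, hX.sum_map_sigRev_cons j _ ht]
  congr 1 <;> refine intervalIntegral.integral_congr fun s hs => ?_ <;>
    rw [Set.uIcc_of_le ht.1] at hs <;> have hs' := Set.Icc_subset_Icc_right ht.2 hs
  · simp only [ih _ (by simp) u (j :: v) hs' rfl]
  · simp only [ih _ (by simp) (i :: u) v hs' rfl]

theorem IsPath.sum_shuffles_sig {X : RawPath α} (hX : IsPath X) (u v : Word α) :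
    ((shuffles u v).map (sig X)).sum = sig X u * sig X v := by
  have h := hX.sum_shuffles_sigRev u.reverse v.reverse (t := X.T) ⟨hX.1.le, le_rfl⟩
  rw [← ((shuffles_reverse_perm u v).map _).sum_eq, List.map_map] at h
  exact h

theorem pair_single (X : RawPath α) (w : Word α) (c : ℝ) :
    pair X (Finsupp.single w c) = c * sig X w := by
  simp [pair]

theorem pair_sum_smul (X : RawPath α) (x : TA β) (f : Word β → TA α) :
    pair X (x.sum fun w c => c • f w) = x.sum fun w c => c * pair X (f w) := by
  simp [pair, Finsupp.sum, map_sum]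

theorem pair_shw {X : RawPath α} (hX : IsPath X) (u v : Word α) :
    pair X (shw u v) = sig X u * sig X v := by
  rw [pair, shw, map_list_sum, List.map_map, ← hX.sum_shuffles_sig]
  simp [Function.comp_def]

theorem pair_sh {X : RawPath α} (hX : IsPath X) (x y : TA α) :
    pair X (sh x y) = pair X x * pair X y := by
  have h : ∀ u v (c : ℝ), Finsupp.linearCombination ℝ (sig X) (c • shw u v) =
      c * (sig X u * sig X v) := fun u v c => by
    rw [map_smul, smul_eq_mul]; congr 1; exact pair_shw hX u v
  simp only [pair, sh, Finsupp.sum, map_sum, h]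
  rw [Finsupp.linearCombination_apply, Finsupp.linearCombination_apply, Finsupp.sum,
    Finsupp.sum, Finset.sum_mul_sum]
  refine Finset.sum_congr rfl fun u _ => Finset.sum_congr rfl fun v _ => ?_
  simp only [smul_eq_mul]
  ring

/-- The iterated convolution `s_j * s_{j+1} * ⋯ * s_{j+k-1}`. -/
noncomputable def convFold (s : ℕ → Word α → ℝ) : ℕ → ℕ → Word α → ℝ
  | _, 0 => counit
  | j, k + 1 => conv (s j) (convFold s (j + 1) k)

theorem convFold_succ (s : ℕ → Word α → ℝ) (j k : ℕ) :
    convFold s j (k + 1) = conv (convFold s j k) (s (j + k)) := by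
  induction k generalizing j with
  | zero =>
    funext w
    simp only [convFold]
    rw [conv_counit_right, conv_counit_left, add_zero]
  | succ k ih =>
    funext w
    rw [convFold, ih, convFold, conv_assoc, add_right_comm, add_assoc j k 1]

theorem pair_splitEmb {X : RawPath β} (hX : IsPath X) (e : ℕ → α → β) (j k : ℕ) (w : Word α) :
    pair X (splitEmb e j k w) = convFold (fun l u => sig X (u.map (e l))) j k w := by
  induction k generalizing j w with
  | zero =>
    cases w <;> simp [splitEmb, convFold, counit, pair, sig, sigUpTo, sigRev]
  | succ k ih =>
    rw [splitEmb, pair, map_sum, convFold, conv]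
    refine Finset.sum_congr rfl fun m _ => ?_
    rw [← ih]
    refine (pair_sh hX _ _).trans ?_
    rw [pair_single, one_mul]

theorem sigRev_map (X : ℝ → β → ℝ) (e : α → β) (w : Word α) (t : ℝ) :
    sigRev X (w.map e) t = sigRev (fun t i => X t (e i)) w t := by
  induction w generalizing t with
  | nil => rfl
  | cons i w ih => simp only [List.map_cons, sigRev, ih]

theorem sig_map (X : RawPath β) (e : α → β) (w : Word α) :
    sig X (w.map e) = sig (⟨X.T, fun t i => X.toFun t (e i)⟩ : RawPath α) w := by
  simp only [sig, sigUpTo, ← List.map_reverse, sigRev_map]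

theorem deriv_concat_left (X Y : RawPath α) (i : α) {t : ℝ} (ht : t < X.T) :
    deriv (fun u => (concat X Y).toFun u i) t = deriv (fun u => X.toFun u i) t :=
  Filter.EventuallyEq.deriv_eq
    ((concat_eqOn_left X Y i).eventuallyEq_of_mem (Iic_mem_nhds ht))

theorem deriv_concat_right (X Y : RawPath α) (i : α) {t : ℝ} (ht : 0 < t) :
    deriv (fun u => (concat X Y).toFun u i) (X.T + t) = deriv (fun u => Y.toFun u i) t := by
  rw [Filter.EventuallyEq.deriv_eq ((concat_eqOn_right X Y i).eventuallyEq_of_mem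
    (Ici_mem_nhds (lt_add_of_pos_right X.T ht)))]
  simp only [deriv_sub_const, deriv_add_const]
  rw [deriv_comp_sub_const (f := fun u => Y.toFun u i), add_sub_cancel_left]

theorem sigRev_concat_left (X Y : RawPath α) (w : Word α) {t : ℝ} (ht : t ∈ Set.Icc 0 X.T) :
    sigRev (concat X Y).toFun w t = sigRev X.toFun w t := by
  induction w generalizing t with
  | nil => rfl
  | cons i w ih =>
    refine intervalIntegral.integral_congr_uIoo fun s hs => ?_
    rw [Set.uIoo_of_le ht.1] at hs
    have hsT : s < X.T := hs.2.trans_le ht.2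
    simp only [ih ⟨hs.1.le, hsT.le⟩, deriv_concat_left X Y i hsT]

theorem conv_integral_left {r : ℝ} (F : Word α → ℝ → ℝ) (g : Word α → ℝ) (w : Word α)
    (hF : ∀ u, IntervalIntegrable (F u) volume 0 r) :
    conv (fun u => ∫ s in (0 : ℝ)..r, F u s) g w =
      ∫ s in (0 : ℝ)..r, conv (fun u => F u s) g w := by
  simp only [conv]
  rw [intervalIntegral.integral_finsetSum fun m _ => (hF _).mul_const _]
  simp only [intervalIntegral.integral_mul_const]

theorem conv_mul_const_left (c : ℝ) (f g : Word α → ℝ) (w : Word α) :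
    conv (fun u => f u * c) g w = conv f g w * c := by
  simp only [mul_comm _ c, conv_const_mul_left]

/-- Chen's identity for reversed words. -/
theorem sigRev_concat {X Y : RawPath α} (hX : IsPath X) (hY : IsPath Y) (w : Word α) {r : ℝ}
    (hr : r ∈ Set.Icc 0 Y.T) :
    sigRev (concat X Y).toFun w (X.T + r) =
      conv (fun u => sigRev Y.toFun u r) (fun u => sigRev X.toFun u X.T) w := by
  induction w generalizing r with
  | nil => simp [conv_nil, sigRev]
  | cons i w ih =>
    have hZ := isPath_concat hX hY
    have hZT : (concat X Y).T = X.T + Y.T := rfl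
    have hI : ∀ t ∈ Set.Icc 0 (concat X Y).T, IntervalIntegrable
        (fun s => sigRev (concat X Y).toFun w s * deriv (fun u => (concat X Y).toFun u i) s)
        volume 0 t := fun t ht =>
      hZ.intervalIntegrable_mul_deriv (hZ.continuousOn_sigRev w) i ht
    have hXT : X.T ∈ Set.Icc 0 (concat X Y).T := ⟨hX.1.le, by linarith [hY.1]⟩
    have hXr : X.T + r ∈ Set.Icc 0 (concat X Y).T :=
      ⟨by linarith [hX.1, hr.1], by linarith [hr.2]⟩
    have hsplit := intervalIntegral.integral_add_adjacent_intervals (hI _ hXT)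
      ((hI _ hXT).symm.trans (hI _ hXr))
    have hleft := sigRev_concat_left X Y (i :: w) (t := X.T) ⟨hX.1.le, le_rfl⟩
    rw [conv_cons]
    simp only [sigRev] at hleft ⊢
    rw [← hsplit, hleft, one_mul, conv_integral_left _ _ _ fun u =>
      hY.intervalIntegrable_mul_deriv (hY.continuousOn_sigRev u) i hr]
    congr 1
    have hshift := intervalIntegral.integral_comp_add_left (a := 0) (b := r)
      (fun s => sigRev (concat X Y).toFun w s * deriv (fun u => (concat X Y).toFun u i) s) X.T
    rw [add_zero] at hshift
    rw [← hshift]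
    refine intervalIntegral.integral_congr_uIoo fun s hs => ?_
    rw [Set.uIoo_of_le hr.1] at hs
    simp only [ih ⟨hs.1.le, hs.2.le.trans hr.2⟩, deriv_concat_right X Y i hs.1,
      conv_mul_const_left]

/-- Chen's identity. -/
theorem sig_concat {X Y : RawPath α} (hX : IsPath X) (hY : IsPath Y) :
    sig (concat X Y) = conv (sig X) (sig Y) := by
  funext w
  refine (sigRev_concat hX hY w.reverse (r := Y.T) ⟨hY.1.le, le_rfl⟩).trans ?_
  rw [conv_reverse]
  rfl

theorem isPath_concatFold {f : ℕ → RawPath α} (hf : ∀ k, IsPath (f k)) (k : ℕ) :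
    IsPath (concatFold f k) := by
  induction k with
  | zero => exact hf 0
  | succ k ih => exact isPath_concat ih (hf (k + 1))

theorem sig_concatFold {f : ℕ → RawPath α} (hf : ∀ k, IsPath (f k)) (k : ℕ) :
    sig (concatFold f k) = convFold (fun l => sig (f l)) 0 (k + 1) := by
  induction k with
  | zero =>
    funext w
    rw [concatFold, convFold, convFold, conv_counit_right]
  | succ k ih =>
    rw [concatFold, sig_concat (isPath_concatFold hf k) (hf (k + 1)), ih, convFold_succ _ 0 (k + 1),
      zero_add]

theorem concatIter_eq_concatFold (X : RawPath α) (k : ℕ) :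
    concatIter X k = concatFold (fun _ => X) k := by
  induction k with
  | zero => rfl
  | succ k ih => rw [concatIter, concatFold, ih]

theorem pair_sum_splitEmb {n : ℕ} (hn : 0 < n) {Z : RawPath β} (hZ : IsPath Z)
    {f : ℕ → RawPath α} (hf : ∀ k, IsPath (f k)) (e : ℕ → α → β)
    (h : ∀ j w, sig Z (w.map (e j)) = sig (f j) w) (x : TA α) :
    pair Z (x.sum fun w c => c • splitEmb e 0 n w) = pair (concatFold f (n - 1)) x := by
  rw [pair_sum_smul, pair, Finsupp.linearCombination_apply, sig_concatFold hf,
    Nat.sub_add_cancel hn]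
  simp only [pair_splitEmb hZ, h, smul_eq_mul]

theorem mem_V_image_splitEmb_iff {n : ℕ} (hn : 0 < n) {Z : RawPath β} (hZ : IsPath Z)
    {f : ℕ → RawPath α} (hf : ∀ k, IsPath (f k)) (e : ℕ → α → β)
    (h : ∀ j w, sig Z (w.map (e j)) = sig (f j) w) (W : Set (TA α)) :
    Z ∈ V ((fun x : TA α => x.sum fun w c => c • splitEmb e 0 n w) '' W) ↔
      concatFold f (n - 1) ∈ V W := by
  simp only [V, Set.mem_ofPred_eq, Set.forall_mem_image, pair_sum_splitEmb hn hZ hf e h, hZ,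
    isPath_concatFold hf, true_and]

end Signature

/-- (1) The set of paths `X` with `X^{⊔n} ∈ 𝒱(W)` is the path variety
of the tensors `Σ_{x=u₁⋯uₙ} u₁⧢⋯⧢uₙ`, `x ∈ W`.  (2) Identifying an `n`-tuple of paths
in `ℝ^d` (on a common time domain) with a path in `ℝ^{nd}` (letters `Fin n × Fin d`),
the tuples with `X₁⊔⋯⊔Xₙ ∈ 𝒱(W)` form the path variety of the tensors
`Σ_{x=u₁⋯uₙ} ι₁(u₁)⧢⋯⧢ιₙ(uₙ)`, `x ∈ W`. -/
theorem statement4 {d n : ℕ} (hn : 0 < n) (W : Set (TA (Fin d))) :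
    ({X : RawPath (Fin d) | IsPath X ∧ concatPow X n ∈ V W} =
        V ((fun x : TA (Fin d) =>
          x.sum fun w c => c • splitEmb (fun _ (i : Fin d) => i) 0 n w) '' W)) ∧
    (∀ (T : ℝ) (Xs : Fin n → ℝ → Fin d → ℝ),
      (∀ j, IsPath (⟨T, Xs j⟩ : RawPath (Fin d))) →
      ((⟨T, fun t p => Xs p.1 t p.2⟩ : RawPath (Fin n × Fin d)) ∈
          V ((fun x : TA (Fin d) =>
            x.sum fun w c => c • splitEmb
              (fun j (i : Fin d) => ((⟨j % n, Nat.mod_lt j hn⟩ : Fin n), i)) 0 n w) '' W)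
        ↔ concatFold (fun k => (⟨T, Xs ⟨k % n, Nat.mod_lt k hn⟩⟩ : RawPath (Fin d)))
            (n - 1) ∈ V W)) := by
  refine ⟨Set.ext fun X => ?_, fun T Xs hXs => ?_⟩
  · have key (hX : IsPath X) := mem_V_image_splitEmb_iff hn hX (f := fun _ => X) (fun _ => hX)
      (fun _ (i : Fin d) => i) (fun _ w => by rw [List.map_id']) W
    rw [Set.mem_ofPred_eq, concatPow, concatIter_eq_concatFold]
    exact ⟨fun h => (key h.1).mpr h.2, fun h => ⟨h.1, (key h.1).mp h⟩⟩
  · have : Nonempty (Fin n) := ⟨⟨0, hn⟩⟩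
    exact mem_V_image_splitEmb_iff hn (isPath_pi hXs) (fun k => hXs _) _
      (fun j w => sig_map _ _ w) W

end PathVarieties
end

section
/- Let M be a nonempty set of paths in ℝ^d such that for every X : [0,T] → ℝ^d in M and every s ∈ [0,T], the right subpath X|_{[s,T]} also belongs to M. Then ℐ(M) is contained in T^{≥1}(ℝ^d) and ℐ(M) is a ≺-ideal: for every x ∈ ℐ(M) and every y ∈ T^{≥1}(ℝ^d), both x≺y ∈ ℐ(M) and y≺x ∈ ℐ(M). -/
open scoped BigOperators TensorProduct

namespace PathVarieties

section IteratedIntegrals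

open MeasureTheory Set Topology

/-- An integrable function on `[0,T]`, continuous at the interior points outside `S`. -/
structure IsIntegrand (T : ℝ) (S : Set ℝ) (h : ℝ → ℝ) : Prop where
  integrable : IntervalIntegrable h volume 0 T
  continuousAt : ∀ x ∈ Ioo 0 T \ S, ContinuousAt h x

/-- A continuous function `f` on `[0,T]` which, outside `S`, has the integrable derivative `f'`. -/
structure IsPrimitive (T : ℝ) (S : Set ℝ) (f f' : ℝ → ℝ) : Prop where
  continuousOn : ContinuousOn f (Icc 0 T)
  hasDerivAt : ∀ x ∈ Ioo 0 T \ S, HasDerivAt f (f' x) x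
  integrable : IntervalIntegrable f' volume 0 T

variable {T : ℝ} {S : Set ℝ} {f f' k k' h : ℝ → ℝ}

theorem IsPrimitive.const (c : ℝ) : IsPrimitive T S (fun _ => c) (fun _ => 0) :=
  ⟨continuousOn_const, fun x _ => hasDerivAt_const x c, by simp⟩

theorem IsPrimitive.mul (hT : 0 ≤ T) (hf : IsPrimitive T S f f') (hk : IsPrimitive T S k k') :
    IsPrimitive T S (fun t => f t * k t) (fun t => f' t * k t + f t * k' t) where
  continuousOn := hf.continuousOn.mul hk.continuousOn
  hasDerivAt x hx := (hf.hasDerivAt x hx).mul (hk.hasDerivAt x hx)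
  integrable := by
    have hf' := hf.continuousOn
    have hk' := hk.continuousOn
    rw [← uIcc_of_le hT] at hf' hk'
    exact (hf.integrable.mul_continuousOn hk').add (hk.integrable.continuousOn_mul hf')

theorem IsPrimitive.integral_eq (hS : S.Countable) (hf : IsPrimitive T S f f') {r : ℝ}
    (hr : r ∈ Icc 0 T) : ∫ u in r..T, f' u = f T - f r := by
  refine integral_eq_of_hasDerivAt_off_countable_of_le f f' hr.2 hS
    (hf.continuousOn.mono (Icc_subset_Icc_left hr.1))
    (fun x hx => hf.hasDerivAt x ⟨Ioo_subset_Ioo_left hr.1 hx.1, hx.2⟩)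
    (hf.integrable.mono_set ?_)
  rw [uIcc_of_le hr.2, uIcc_of_le (hr.1.trans hr.2)]
  exact Icc_subset_Icc_left hr.1

theorem IsIntegrand.mul_primitive (hT : 0 ≤ T) (hh : IsIntegrand T S h)
    (hf : IsPrimitive T S f f') : IsIntegrand T S (fun t => h t * f t) where
  integrable := hh.integrable.mul_continuousOn (by rw [uIcc_of_le hT]; exact hf.continuousOn)
  continuousAt x hx := (hh.continuousAt x hx).mul (hf.hasDerivAt x hx).continuousAt

theorem IsIntegrand.stronglyMeasurableAtFilter (hh : IsIntegrand T S h) {x : ℝ}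
    (hx : x ∈ Ioo 0 T) : StronglyMeasurableAtFilter h (𝓝 x) :=
  ⟨Ioc 0 T, Ioc_mem_nhds hx.1 hx.2, hh.integrable.1.aestronglyMeasurable⟩

theorem IsIntegrand.mono_integrable (hh : IsIntegrand T S h) {a b : ℝ} (ha : a ∈ Icc 0 T)
    (hb : b ∈ Icc 0 T) : IntervalIntegrable h volume a b :=
  hh.integrable.mono_set (by
    rw [uIcc_of_le (ha.1.trans ha.2)]; exact uIcc_subset_Icc ha hb)

theorem IsIntegrand.isPrimitive_left (hT : 0 ≤ T) (hh : IsIntegrand T S h) :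
    IsPrimitive T S (fun t => ∫ u in (0 : ℝ)..t, h u) h where
  continuousOn := by
    have := intervalIntegral.continuousOn_primitive_interval' hh.integrable left_mem_uIcc
    rwa [uIcc_of_le hT] at this
  hasDerivAt x hx := intervalIntegral.integral_hasDerivAt_right
    (hh.mono_integrable (left_mem_Icc.2 hT) (Ioo_subset_Icc_self hx.1))
    (hh.stronglyMeasurableAtFilter hx.1) (hh.continuousAt x hx)
  integrable := hh.integrable

theorem IsIntegrand.isPrimitive_right (hT : 0 ≤ T) (hh : IsIntegrand T S h) :
    IsPrimitive T S (fun t => ∫ u in t..T, h u) (fun t => -h t) where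
  continuousOn := by
    have := (intervalIntegral.continuousOn_primitive_interval' hh.integrable right_mem_uIcc).neg
    rw [uIcc_of_le hT] at this
    exact this.congr fun x _ => intervalIntegral.integral_symm _ _
  hasDerivAt x hx := intervalIntegral.integral_hasDerivAt_left
    (hh.mono_integrable (Ioo_subset_Icc_self hx.1) (right_mem_Icc.2 hT))
    (hh.stronglyMeasurableAtFilter hx.1) (hh.continuousAt x hx)
  integrable := hh.integrable.neg

/-- Iterated integrals of `g` from `0` to `t`, by recursion on the reversed word. -/
noncomputable def fwd {α : Type*} (g : α → ℝ → ℝ) : Word α → ℝ → ℝ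
  | [], _ => 1
  | i :: w, t => ∫ s in (0 : ℝ)..t, g i s * fwd g w s

/-- Iterated integrals of `g` from `t` to `T`, by recursion on the word. -/
noncomputable def bwd {α : Type*} (g : α → ℝ → ℝ) (T : ℝ) : Word α → ℝ → ℝ
  | [], _ => 1
  | i :: w, t => ∫ s in t..T, g i s * bwd g T w s

/-- The derivative of `fwd g w`. -/
noncomputable def fwdDeriv {α : Type*} (g : α → ℝ → ℝ) : Word α → ℝ → ℝ
  | [], _ => 0
  | i :: w, t => g i t * fwd g w t

/-- The derivative of `bwd g T w`. -/
noncomputable def bwdDeriv {α : Type*} (g : α → ℝ → ℝ) (T : ℝ) : Word α → ℝ → ℝ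
  | [], _ => 0
  | i :: w, t => -(g i t * bwd g T w t)

variable {α : Type*} {g : α → ℝ → ℝ}

theorem isPrimitive_fwd (hT : 0 ≤ T) (hg : ∀ i, IsIntegrand T S (g i)) :
    ∀ w : Word α, IsPrimitive T S (fwd g w) (fwdDeriv g w)
  | [] => IsPrimitive.const 1
  | i :: w => ((hg i).mul_primitive hT (isPrimitive_fwd hT hg w)).isPrimitive_left hT

theorem isPrimitive_bwd (hT : 0 ≤ T) (hg : ∀ i, IsIntegrand T S (g i)) :
    ∀ w : Word α, IsPrimitive T S (bwd g T w) (bwdDeriv g T w)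
  | [] => IsPrimitive.const 1
  | i :: w => ((hg i).mul_primitive hT (isPrimitive_bwd hT hg w)).isPrimitive_right hT

theorem isIntegrand_mul_bwd (hT : 0 ≤ T) (hg : ∀ i, IsIntegrand T S (g i)) (a : α) (w : Word α) :
    IsIntegrand T S (fun u => g a u * bwd g T w u) :=
  (hg a).mul_primitive hT (isPrimitive_bwd hT hg w)

@[simp] theorem bwd_cons_self (i : α) (w : Word α) : bwd g T (i :: w) T = 0 := by
  simp [bwd]

theorem integral_mul_fwd_mul_bwd (hT : 0 ≤ T) (hS : S.Countable)
    (hg : ∀ i, IsIntegrand T S (g i)) (a : α) (p w : Word α) :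
    ∫ u in (0 : ℝ)..T, g a u * fwd g p u * bwd g T w u = fwd g (w.reverse ++ a :: p) T := by
  induction w generalizing a p with
  | nil => simp [bwd, fwd]
  | cons b w ih =>
    have hprod := (isPrimitive_fwd hT hg (a :: p)).mul hT (isPrimitive_bwd hT hg (b :: w))
    have key := hprod.integral_eq hS (left_mem_Icc.2 hT)
    have h₁ : IntervalIntegrable (fun u => g a u * fwd g p u * bwd g T (b :: w) u) volume 0 T :=
      (((hg a).mul_primitive hT (isPrimitive_fwd hT hg p)).mul_primitive hT
        (isPrimitive_bwd hT hg (b :: w))).integrable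
    have h₂ : IntervalIntegrable (fun u => g b u * fwd g (a :: p) u * bwd g T w u) volume 0 T :=
      (((hg b).mul_primitive hT (isPrimitive_fwd hT hg (a :: p))).mul_primitive hT
        (isPrimitive_bwd hT hg w)).integrable
    have hsub : ∫ u in (0 : ℝ)..T, (g a u * fwd g p u * bwd g T (b :: w) u -
        g b u * fwd g (a :: p) u * bwd g T w u) = 0 := by
      have h0 : fwd g (a :: p) 0 = 0 := by simp [fwd]
      rw [bwd_cons_self, h0] at key
      simp only [mul_zero, zero_mul, sub_zero] at key
      refine Eq.trans (intervalIntegral.integral_congr fun u _ => ?_) key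
      simp only [fwdDeriv, bwdDeriv]
      ring
    rw [intervalIntegral.integral_sub h₁ h₂, ih] at hsub
    rw [sub_eq_zero.1 hsub]
    simp

theorem fwd_reverse_eq_bwd (hT : 0 ≤ T) (hS : S.Countable) (hg : ∀ i, IsIntegrand T S (g i))
    (w : Word α) : fwd g w.reverse T = bwd g T w 0 := by
  cases w with
  | nil => rfl
  | cons a w =>
    have := integral_mul_fwd_mul_bwd hT hS hg a [] w
    simp only [fwd, mul_one] at this
    simp [bwd, this]

theorem bwd_mul_bwd (hT : 0 ≤ T) (hS : S.Countable) (hg : ∀ i, IsIntegrand T S (g i))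
    (a b : α) (u v : Word α) {r : ℝ} (hr : r ∈ Icc 0 T) :
    bwd g T (a :: u) r * bwd g T (b :: v) r =
      (∫ s in r..T, g a s * (bwd g T u s * bwd g T (b :: v) s)) +
        ∫ s in r..T, g b s * (bwd g T (a :: u) s * bwd g T v s) := by
  have key := ((isPrimitive_bwd hT hg (a :: u)).mul hT
    (isPrimitive_bwd hT hg (b :: v))).integral_eq hS hr
  have hint (c : α) (p q : Word α) :
      IntervalIntegrable (fun s => g c s * (bwd g T p s * bwd g T q s)) volume r T :=
    ((hg c).mul_primitive hT ((isPrimitive_bwd hT hg p).mul hT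
      (isPrimitive_bwd hT hg q))).mono_integrable hr (right_mem_Icc.2 hT)
  rw [← intervalIntegral.integral_add (hint a u (b :: v)) (hint b (a :: u) v), ← neg_inj,
    ← intervalIntegral.integral_neg]
  simp only [bwd_cons_self, mul_zero, zero_sub] at key
  rw [← key]
  refine intervalIntegral.integral_congr fun s _ => ?_
  simp only [bwdDeriv]
  ring

theorem sum_map_bwd_cons (hT : 0 ≤ T) (hg : ∀ i, IsIntegrand T S (g i))
    (a : α) (L : List (Word α)) {r : ℝ} (hr : r ∈ Icc 0 T) :
    (L.map fun w => bwd g T (a :: w) r).sum =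
      ∫ s in r..T, g a s * (L.map fun w => bwd g T w s).sum := by
  have hmem : T ∈ Icc 0 T := right_mem_Icc.2 hT
  suffices h : IntervalIntegrable (fun s => g a s * (L.map fun w => bwd g T w s).sum) volume r T ∧
      (L.map fun w => bwd g T (a :: w) r).sum =
        ∫ s in r..T, g a s * (L.map fun w => bwd g T w s).sum from h.2
  induction L with
  | nil => simp
  | cons w L ih =>
    have hw := (isIntegrand_mul_bwd hT hg a w).mono_integrable hr hmem
    simp only [List.map_cons, List.sum_cons, mul_add]
    exact ⟨hw.add ih.1, by rw [intervalIntegral.integral_add hw ih.1, ih.2]; rfl⟩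

theorem sum_shuffles_bwd (hT : 0 ≤ T) (hS : S.Countable) (hg : ∀ i, IsIntegrand T S (g i))
    (u v : Word α) {r : ℝ} (hr : r ∈ Icc 0 T) :
    ((shuffles u v).map fun w => bwd g T w r).sum = bwd g T u r * bwd g T v r := by
  induction u, v using shuffles.induct generalizing r with
  | case1 v => simp [shuffles, bwd]
  | case2 a u => simp [shuffles, bwd]
  | case3 a u b v ih₁ ih₂ =>
    have hsub : ∀ s ∈ uIcc r T, s ∈ Icc 0 T := fun s hs => by
      rw [uIcc_of_le hr.2] at hs
      exact ⟨hr.1.trans hs.1, hs.2⟩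
    rw [shuffles, List.map_append, List.sum_append, List.map_map, List.map_map,
      bwd_mul_bwd hT hS hg a b u v hr]
    congr 1
    · refine (sum_map_bwd_cons hT hg a _ hr).trans ?_
      exact intervalIntegral.integral_congr fun s hs => by simp only [ih₁ (hsub s hs)]
    · refine (sum_map_bwd_cons hT hg b _ hr).trans ?_
      exact intervalIntegral.integral_congr fun s hs => by simp only [ih₂ (hsub s hs)]

end IteratedIntegrals

section Paths

open MeasureTheory Set Topology

variable {α : Type*}

/-- The velocity of a path, coordinate by coordinate. -/
noncomputable def velocity (X : RawPath α) (i : α) (s : ℝ) : ℝ :=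
  deriv (fun t => X.toFun t i) s

theorem intervalIntegrable_deriv_of_contDiffOn {f : ℝ → ℝ} {a b : ℝ} (hab : a < b)
    (hf : ContDiffOn ℝ 1 f (Icc a b)) : IntervalIntegrable (deriv f) volume a b := by
  have hc := hf.continuousOn_derivWithin (uniqueDiffOn_Icc hab) le_rfl
  rw [← uIcc_of_le hab.le] at hc
  refine hc.intervalIntegrable.congr_ae ?_
  rw [uIoc_of_le hab.le, uIcc_of_le hab.le, ← restrict_Ioo_eq_restrict_Ioc]
  filter_upwards [ae_restrict_mem measurableSet_Ioo] with x hx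
  exact derivWithin_of_mem_nhds (Icc_mem_nhds hx.1 hx.2)

theorem exists_between_of_notMem_range {n : ℕ} (τ : Fin (n + 1) → ℝ) {x : ℝ} (h0 : τ 0 < x)
    (hx : x ∉ range τ) (m : Fin (n + 1)) (hm : x < τ m) :
    ∃ k : Fin n, x ∈ Ioo (τ k.castSucc) (τ k.succ) := by
  induction m using Fin.induction with
  | zero => exact absurd hm h0.not_gt
  | succ j ih =>
    rcases lt_trichotomy x (τ j.castSucc) with h | h | h
    · exact ih h
    · exact absurd ⟨_, h.symm⟩ hx
    · exact ⟨j, h, hm⟩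

theorem IsPath.exists_isIntegrand {X : RawPath α} (hX : IsPath X) :
    ∃ S : Set ℝ, S.Countable ∧ ∀ i, IsIntegrand X.T S (velocity X i) := by
  obtain ⟨-, -, n, τ, hτ, h0, hn, hC⟩ := hX
  refine ⟨range τ, countable_range τ, fun i => ⟨?_, fun x hx => ?_⟩⟩
  · have key (m : Fin (n + 1)) : IntervalIntegrable (velocity X i) volume (τ 0) (τ m) := by
      induction m using Fin.induction with
      | zero => exact IntervalIntegrable.refl
      | succ j ih =>
        exact ih.trans (intervalIntegrable_deriv_of_contDiffOn (hτ j.castSucc_lt_succ) (hC j i))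
    simpa [h0, hn] using key (Fin.last n)
  · obtain ⟨k, hk⟩ := exists_between_of_notMem_range τ (h0 ▸ hx.1.1) hx.2 (Fin.last n)
      (hn ▸ hx.1.2)
    exact (((hC k i).mono Ioo_subset_Icc_self).continuousOn_deriv_of_isOpen isOpen_Ioo
      le_rfl).continuousAt (Ioo_mem_nhds hk.1 hk.2)

theorem sigRev_eq_fwd (X : RawPath α) (w : Word α) : sigRev X.toFun w = fwd (velocity X) w := by
  induction w with
  | nil => rfl
  | cons i w ih =>
    funext t
    simp only [sigRev, fwd, ih, velocity, mul_comm]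

theorem IsPath.sig_eq_bwd {X : RawPath α} (hX : IsPath X) (w : Word α) :
    sig X w = bwd (velocity X) X.T w 0 := by
  obtain ⟨S, hS, hg⟩ := hX.exists_isIntegrand
  rw [← fwd_reverse_eq_bwd hX.1.le hS hg, sig, sigUpTo, sigRev_eq_fwd]

/-- The right subpath `X|_{[s,T]}`, reparametrized to start at time `0`. -/
def rightSubpath (X : RawPath α) (s : ℝ) : RawPath α :=
  ⟨X.T - s, fun t i => X.toFun (s + t) i⟩

theorem bwd_rightSubpath (X : RawPath α) (s : ℝ) (w : Word α) (t : ℝ) :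
    bwd (velocity (rightSubpath X s)) (X.T - s) w t = bwd (velocity X) X.T w (s + t) := by
  induction w generalizing t with
  | nil => rfl
  | cons i w ih =>
    have hv (u : ℝ) : velocity (rightSubpath X s) i u = velocity X i (s + u) :=
      deriv_comp_const_add (fun t => X.toFun t i) s u
    simp only [bwd, ih, hv]
    rw [intervalIntegral.integral_comp_add_left
      (fun u => velocity X i u * bwd (velocity X) X.T w u)]
    simp

theorem mem_Idl {M : Set (RawPath α)} {x : TA α} : x ∈ Idl M ↔ ∀ X ∈ M, pair X x = 0 := by
  simp [Idl, pair, Submodule.mem_iInf]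

theorem pair_eq_sum (X : RawPath α) (x : TA α) : pair X x = x.sum fun w c => c * sig X w := by
  simp [pair, Finsupp.linearCombination_apply]

/-- The pairing of `x` with the signature of the part of `X` after time `r`. -/
noncomputable def bwdPair (X : RawPath α) (x : TA α) (r : ℝ) : ℝ :=
  x.sum fun w c => c * bwd (velocity X) X.T w r

theorem IsPath.pair_eq_bwdPair {X : RawPath α} (hX : IsPath X) (x : TA α) :
    pair X x = bwdPair X x 0 := by
  simp [pair_eq_sum, bwdPair, hX.sig_eq_bwd]

theorem IsPath.pair_rightSubpath {X : RawPath α} {s : ℝ} (hX : IsPath (rightSubpath X s))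
    (x : TA α) : pair (rightSubpath X s) x = bwdPair X x s := by
  rw [hX.pair_eq_bwdPair]
  simp only [bwdPair]
  refine Finsupp.sum_congr fun w _ => ?_
  rw [show (rightSubpath X s).T = X.T - s from rfl, bwd_rightSubpath, add_zero]

theorem IsPath.continuousOn_bwdPair {X : RawPath α} (hX : IsPath X) (x : TA α) :
    ContinuousOn (bwdPair X x) (Icc 0 X.T) := by
  obtain ⟨S, -, hg⟩ := hX.exists_isIntegrand
  exact continuousOn_finsetSum _ fun w _ =>
    continuousOn_const.mul (isPrimitive_bwd hX.1.le hg w).continuousOn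

theorem bwdPair_self (X : RawPath α) (x : TA α) : bwdPair X x X.T = x [] := by
  classical
  rw [bwdPair, Finsupp.sum, Finset.sum_eq_single []]
  · simp [bwd]
  · rintro (_ | ⟨i, w⟩) - h
    · exact absurd rfl h
    · simp
  · intro h
    simp [Finsupp.notMem_support_iff.1 h]

/-- A tensor killed by all right subpaths of `X` has vanishing `bwdPair` up to the final time. -/
theorem IsPath.bwdPair_eq_zero {X : RawPath α} (hX : IsPath X) {x : TA α}
    (h : ∀ s, 0 ≤ s → s < X.T → bwdPair X x s = 0) : ∀ s ∈ Icc 0 X.T, bwdPair X x s = 0 := by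
  have hcl : closure (Ico 0 X.T) = Icc 0 X.T := closure_Ico hX.1.ne
  intro s hs
  have hc : ContinuousOn (bwdPair X x) (closure (Ico 0 X.T)) := hcl ▸ hX.continuousOn_bwdPair x
  have heq : EqOn (bwdPair X x) (fun _ => 0) (Ico 0 X.T) := fun s hs => h s hs.1 hs.2
  exact heq.of_subset_closure hc continuousOn_const subset_closure subset_rfl (hcl ▸ hs)

theorem pair_sum_single (X : RawPath α) (L : List (Word α)) :
    pair X (L.map fun w => Finsupp.single w (1 : ℝ)).sum = (L.map (sig X)).sum := by
  induction L with
  | nil => simp [pair]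
  | cons w L ih => simpa [pair] using ih

theorem pair_lsh (X : RawPath α) (x y : TA α) :
    pair X (lsh x y) = x.sum fun u cu => y.sum fun v cv => cu * cv * pair X (lshw u v) := by
  simp [pair, lsh, Finsupp.sum, map_sum]

theorem IsPath.pair_lshw {X : RawPath α} (hX : IsPath X) (a : α) (u v : Word α) :
    pair X (lshw (a :: u) v) = ∫ s in (0 : ℝ)..X.T,
      velocity X a s * (bwd (velocity X) X.T u s * bwd (velocity X) X.T v s) := by
  obtain ⟨S, hS, hg⟩ := hX.exists_isIntegrand
  have h := pair_sum_single X ((shuffles u v).map fun w => a :: w)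
  rw [List.map_map, List.map_map] at h
  refine h.trans ?_
  simp only [Function.comp_def, hX.sig_eq_bwd]
  rw [sum_map_bwd_cons hX.1.le hg a _ (left_mem_Icc.2 hX.1.le)]
  refine intervalIntegral.integral_congr fun s hs => ?_
  rw [uIcc_of_le hX.1.le] at hs
  simp only [sum_shuffles_bwd hX.1.le hS hg u v hs]

theorem IsPath.pair_lshw_add_pair_lshw {X : RawPath α} (hX : IsPath X) {u v : Word α}
    (hu : u ≠ []) (hv : v ≠ []) :
    pair X (lshw u v) + pair X (lshw v u) = sig X u * sig X v := by
  obtain ⟨S, hS, hg⟩ := hX.exists_isIntegrand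
  obtain ⟨a, u, rfl⟩ := List.exists_cons_of_ne_nil hu
  obtain ⟨b, v, rfl⟩ := List.exists_cons_of_ne_nil hv
  rw [hX.pair_lshw, hX.pair_lshw, hX.sig_eq_bwd, hX.sig_eq_bwd,
    bwd_mul_bwd hX.1.le hS hg a b u v (left_mem_Icc.2 hX.1.le)]
  simp only [mul_comm (bwd (velocity X) X.T v _)]

theorem IsPath.pair_lsh_add_pair_lsh {X : RawPath α} (hX : IsPath X) {x y : TA α}
    (hx : x [] = 0) (hy : y [] = 0) :
    pair X (lsh x y) + pair X (lsh y x) = pair X x * pair X y := by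
  rw [pair_lsh, pair_lsh, Finsupp.sum_comm y x, pair_eq_sum X x, pair_eq_sum X y]
  simp only [Finsupp.sum]
  rw [← Finset.sum_add_distrib, Finset.sum_mul_sum]
  refine Finset.sum_congr rfl fun u hu => ?_
  rw [← Finset.sum_add_distrib]
  refine Finset.sum_congr rfl fun v hv => ?_
  have hu' : u ≠ [] := fun h => Finsupp.mem_support_iff.1 hu (h ▸ hx)
  have hv' : v ≠ [] := fun h => Finsupp.mem_support_iff.1 hv (h ▸ hy)
  linear_combination x u * y v * hX.pair_lshw_add_pair_lshw hu' hv'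

theorem IsPath.pair_lsh_eq_zero {X : RawPath α} (hX : IsPath X) {x y : TA α} (hy : y [] = 0)
    (h : ∀ s ∈ Icc 0 X.T, bwdPair X x s = 0) : pair X (lsh y x) = 0 := by
  obtain ⟨S, -, hg⟩ := hX.exists_isIntegrand
  rw [pair_lsh]
  refine Finset.sum_eq_zero fun u hu => ?_
  obtain ⟨a, u, rfl⟩ := List.exists_cons_of_ne_nil
    (fun h => Finsupp.mem_support_iff.1 hu (h ▸ hy) : u ≠ [])
  have hint (v : Word α) : IntervalIntegrable (fun s => y (a :: u) * x v * (velocity X a s *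
      (bwd (velocity X) X.T u s * bwd (velocity X) X.T v s))) volume 0 X.T :=
    (((hg a).mul_primitive hX.1.le ((isPrimitive_bwd hX.1.le hg u).mul hX.1.le
      (isPrimitive_bwd hX.1.le hg v))).integrable).const_mul _
  simp only [Finsupp.sum, hX.pair_lshw, ← intervalIntegral.integral_const_mul]
  rw [← intervalIntegral.integral_finsetSum fun v _ => hint v,
    intervalIntegral.integral_congr (g := fun _ => 0) fun s hs => ?_]
  · simp
  · rw [uIcc_of_le hX.1.le] at hs
    have hs := h s hs
    simp only [bwdPair, Finsupp.sum] at hs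
    calc _ = y (a :: u) * velocity X a s * bwd (velocity X) X.T u s *
          ∑ v ∈ x.support, x v * bwd (velocity X) X.T v s := by
          rw [Finset.mul_sum]
          exact Finset.sum_congr rfl fun v _ => by ring
      _ = 0 := by rw [hs, mul_zero]

end Paths

/-- If a nonempty set `M` of paths contains all right subpaths of its
members, then `ℐ(M) ⊆ T^{≥1}(ℝ^d)` and `ℐ(M)` is a `≺`-ideal. -/
theorem statement8 {d : ℕ} (M : Set (RawPath (Fin d))) (hne : M.Nonempty)
    (hpath : ∀ X ∈ M, IsPath X)
    (hsub : ∀ X ∈ M, ∀ s : ℝ, 0 ≤ s → s < X.T →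
      (⟨X.T - s, fun t i => X.toFun (s + t) i⟩ : RawPath (Fin d)) ∈ M) :
    (∀ x ∈ Idl M, x [] = 0) ∧
    (∀ x ∈ Idl M, ∀ y : TA (Fin d), y [] = 0 →
      lsh x y ∈ Idl M ∧ lsh y x ∈ Idl M) := by
  have hzero : ∀ x ∈ Idl M, ∀ X ∈ M, ∀ s ∈ Set.Icc 0 X.T, bwdPair X x s = 0 :=
    fun x hx X hX => (hpath X hX).bwdPair_eq_zero fun s hs hsT => by
      have hmem : rightSubpath X s ∈ M := hsub X hX s hs hsT
      rw [← (hpath _ hmem).pair_rightSubpath]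
      exact mem_Idl.1 hx _ hmem
  have hnil : ∀ x ∈ Idl M, x [] = 0 := fun x hx => by
    obtain ⟨X, hX⟩ := hne
    rw [← bwdPair_self X x]
    exact hzero x hx X hX X.T (Set.right_mem_Icc.2 (hpath X hX).1.le)
  refine ⟨hnil, fun x hx y hy => ?_⟩
  have hyx : ∀ X ∈ M, pair X (lsh y x) = 0 := fun X hX =>
    (hpath X hX).pair_lsh_eq_zero hy (hzero x hx X hX)
  refine ⟨mem_Idl.2 fun X hX => ?_, mem_Idl.2 hyx⟩
  have := (hpath X hX).pair_lsh_add_pair_lsh (hnil x hx) hy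
  rwa [hyx X hX, mem_Idl.1 hx X hX, zero_mul, add_zero] at this

end PathVarieties
end
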